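/- Let k ≥ 1 be an integer, R > 0, and let x ∈ ℝ^{k+1} be a fixed point with |x| ≠ R. Then for every α ∈ ℂ, the function F(α) = ∫_{S^k(R)} ω(x,y)^α dS_y admits the convergent Taylor expansion at α = k/2 containing only even powers: F(α) = Σ_{m=0}^{∞} ((α − k/2)^{2m} / (2m)!) · ∫_{S^k(R)} ω(x,y)^{k/2} (ln ω(x,y))^{2m} dS_y. -/

import Mathlib

open MeasureTheory

/-- The spherical ratio `ω(x,y) = |‖x‖² − R²| / ‖x − y‖²`. -/
noncomputable def sRatio {n : ℕ} (R : ℝ) (x y : EuclideanSpace ℝ (Fin n)) : ℝ :=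
  |‖x‖ ^ 2 - R ^ 2| / ‖x - y‖ ^ 2

open scoped NNReal ENNReal

/-- An involution of `S` which stretches distances by the geometric mean of the values of a
density `g` satisfying `g ∘ T = g⁻¹` preserves the `d`-dimensional Hausdorff measure on `S`
weighted by `g ^ (d / 2)`, up to a factor arbitrarily close to one. -/
theorem map_withDensity_hausdorffMeasure_le_mul {X : Type*} [MetricSpace X] [MeasurableSpace X]
    [BorelSpace X] {d : ℝ} (hd : 0 ≤ d) {S : Set X} {T : X → X}
    (hT : Measurable T) (hTT : Function.Involutive T) (hTS : ∀ y ∈ S, T y ∈ S)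
    {g : X → ℝ≥0} (hg : Measurable g) (hg0 : ∀ y ∈ S, g y ≠ 0)
    (hgT : ∀ y ∈ S, g (T y) = (g y)⁻¹)
    (hdist : ∀ y ∈ S, ∀ z ∈ S, dist (T y) (T z) ^ 2 = g y * g z * dist y z ^ 2)
    {t : ℝ≥0} (ht : 1 < t) :
    ((μH[d].restrict S).withDensity fun y => ((g y ^ (d / 2) : ℝ≥0) : ℝ≥0∞)).map T ≤
      ((t : ℝ≥0∞) ^ d) •
        (μH[d].restrict S).withDensity fun y => ((g y ^ (d / 2) : ℝ≥0) : ℝ≥0∞) := by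
  set ν := (μH[d].restrict S).withDensity fun y => ((g y ^ (d / 2) : ℝ≥0) : ℝ≥0∞) with hν
  have t0 : 0 < t := one_pos.trans ht
  have hf : Measurable fun y => (g y : ℝ≥0∞) := hg.coe_nnreal_ennreal
  have hνapply : ∀ A, MeasurableSet A →
      ν A = ∫⁻ y in A ∩ S, ((g y ^ (d / 2) : ℝ≥0) : ℝ≥0∞) ∂μH[d] := by
    intro A hA
    rw [hν, withDensity_apply _ hA, Measure.restrict_restrict hA]
  have hpre : ∀ A, T ⁻¹' A ∩ S = T '' (A ∩ S) := by
    intro A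
    ext y
    constructor
    · rintro ⟨h1, h2⟩
      exact ⟨T y, ⟨h1, hTS y h2⟩, hTT y⟩
    · rintro ⟨z, ⟨h1, h2⟩, rfl⟩
      exact ⟨by simpa [hTT z] using h1, hTS z h2⟩
  have hpiece : ∀ A, MeasurableSet A → ∀ a : ℝ≥0, 0 < a →
      (∀ y ∈ A, a ≤ g y ∧ g y < a * t) → ν (T ⁻¹' A) ≤ (t : ℝ≥0∞) ^ d * ν A := by
    intro A hA a ha hAg
    have hlip : LipschitzOnWith (a * t) T (A ∩ S) := by
      refine LipschitzOnWith.of_dist_le_mul fun y hy z hz => ?_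
      refine (sq_le_sq₀ dist_nonneg (by positivity)).1 ?_
      rw [hdist y hy.2 z hz.2, mul_pow, sq ((a * t : ℝ≥0) : ℝ)]
      have h1 : (g y : ℝ) ≤ (a * t : ℝ≥0) := NNReal.coe_le_coe.2 (hAg y hy.1).2.le
      have h2 : (g z : ℝ) ≤ (a * t : ℝ≥0) := NNReal.coe_le_coe.2 (hAg z hz.1).2.le
      gcongr
    have hH := hlip.hausdorffMeasure_image_le hd
    have hA' : MeasurableSet (T ⁻¹' A) := hT hA
    calc ν (T ⁻¹' A)
        ≤ ∫⁻ y in T ⁻¹' A ∩ S, ((a⁻¹ ^ (d / 2) : ℝ≥0) : ℝ≥0∞) ∂μH[d] := by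
          rw [hνapply _ hA']
          refine setLIntegral_mono measurable_const fun y hy => ?_
          have h1 : g y ≤ a⁻¹ := by
            have h2 := (hAg _ hy.1).1
            rw [hgT y hy.2] at h2
            exact (le_inv_comm₀ ha (pos_iff_ne_zero.2 (hg0 y hy.2))).1 h2
          gcongr
      _ = ((a⁻¹ ^ (d / 2) : ℝ≥0) : ℝ≥0∞) * μH[d] (T '' (A ∩ S)) := by
          rw [setLIntegral_const, hpre]
      _ ≤ ((a⁻¹ ^ (d / 2) : ℝ≥0) : ℝ≥0∞) * (((a * t : ℝ≥0) : ℝ≥0∞) ^ d * μH[d] (A ∩ S)) := by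
          gcongr
      _ = (t : ℝ≥0∞) ^ d * (((a ^ (d / 2) : ℝ≥0) : ℝ≥0∞) * μH[d] (A ∩ S)) := by
          rw [← ENNReal.coe_rpow_of_nonneg _ hd, ← ENNReal.coe_rpow_of_nonneg _ hd, ← mul_assoc,
            ← mul_assoc, ← ENNReal.coe_mul, ← ENNReal.coe_mul]
          congr 2
          rw [NNReal.mul_rpow, NNReal.inv_rpow]
          have h1 : a ^ d = a ^ (d / 2) * a ^ (d / 2) := by
            rw [← NNReal.rpow_add ha.ne']; ring_nf
          have h2 : a ^ (d / 2) ≠ 0 := (NNReal.rpow_pos ha).ne'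
          rw [h1]
          field_simp
      _ ≤ (t : ℝ≥0∞) ^ d * ν A := by
          rw [hνapply _ hA, ← setLIntegral_const]
          refine mul_le_mul' le_rfl ?_
          refine setLIntegral_mono (hg.pow_const _).coe_nnreal_ennreal fun y hy => ?_
          have := (hAg y hy.1).1
          gcongr
  have hnull : ∀ A, MeasurableSet A → A ∩ S = ∅ → ν A = 0 := by
    intro A hA h
    rw [hνapply A hA, h]
    simp
  refine Measure.le_iff.2 fun B hB => ?_
  rw [measure_eq_measure_preimage_add_measure_tsum_Ico_zpow (ν.map T) hf hB ht,
    Measure.smul_apply, measure_eq_measure_preimage_add_measure_tsum_Ico_zpow ν hf hB ht,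
    smul_eq_mul, mul_add, ← ENNReal.tsum_mul_left]
  have hz : MeasurableSet (B ∩ (fun y => (g y : ℝ≥0∞)) ⁻¹' {0}) :=
    hB.inter (hf (measurableSet_singleton _))
  have h0 : ν.map T (B ∩ (fun y => (g y : ℝ≥0∞)) ⁻¹' {0}) = 0 := by
    rw [Measure.map_apply hT hz]
    refine hnull _ (hT hz) ?_
    refine Set.eq_empty_of_forall_notMem fun y hy => ?_
    have := hy.1.2
    simp only [Set.mem_preimage, Set.mem_singleton_iff, ENNReal.coe_eq_zero] at this
    exact hg0 _ (hTS y hy.2) this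
  have htop : ν.map T (B ∩ (fun y => (g y : ℝ≥0∞)) ⁻¹' {∞}) = 0 := by
    have : (fun y => (g y : ℝ≥0∞)) ⁻¹' {∞} = ∅ := by ext; simp
    simp [this]
  rw [h0, htop, zero_add, zero_add]
  refine le_add_left (ENNReal.tsum_le_tsum fun n => ?_)
  have hm : MeasurableSet
      (B ∩ (fun y => (g y : ℝ≥0∞)) ⁻¹' Set.Ico ((t : ℝ≥0∞) ^ n) ((t : ℝ≥0∞) ^ (n + 1))) :=
    hB.inter (hf measurableSet_Ico)
  rw [Measure.map_apply hT hm]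
  refine hpiece _ hm (t ^ n) (zpow_pos t0 n) fun y hy => ?_
  have h := hy.2
  rw [Set.mem_preimage, Set.mem_Ico, ← ENNReal.coe_zpow t0.ne', ← ENNReal.coe_zpow t0.ne',
    ENNReal.coe_le_coe, ENNReal.coe_lt_coe, zpow_add_one₀ t0.ne'] at h
  exact h

/-- An involution of `S` which stretches distances by the geometric mean of the values of a
density `g` satisfying `g ∘ T = g⁻¹` preserves the `d`-dimensional Hausdorff measure on `S`
weighted by `g ^ (d / 2)`. -/
theorem measurePreserving_withDensity_hausdorffMeasure {X : Type*} [MetricSpace X]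
    [MeasurableSpace X] [BorelSpace X] {d : ℝ} (hd : 0 ≤ d) {S : Set X}
    {T : X → X} (hT : Measurable T) (hTT : Function.Involutive T) (hTS : ∀ y ∈ S, T y ∈ S)
    {g : X → ℝ≥0} (hg : Measurable g) (hg0 : ∀ y ∈ S, g y ≠ 0)
    (hgT : ∀ y ∈ S, g (T y) = (g y)⁻¹)
    (hdist : ∀ y ∈ S, ∀ z ∈ S, dist (T y) (T z) ^ 2 = g y * g z * dist y z ^ 2) :
    MeasurePreserving T
      ((μH[d].restrict S).withDensity fun y => ((g y ^ (d / 2) : ℝ≥0) : ℝ≥0∞))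
      ((μH[d].restrict S).withDensity fun y => ((g y ^ (d / 2) : ℝ≥0) : ℝ≥0∞)) := by
  refine ⟨hT, ?_⟩
  set ν := (μH[d].restrict S).withDensity fun y => ((g y ^ (d / 2) : ℝ≥0) : ℝ≥0∞) with hν
  have hle : ν.map T ≤ ν := by
    refine Measure.le_iff.2 fun B hB => ?_
    have h1 : ∀ t : ℝ≥0, 1 < t → ν.map T B ≤ ((t ^ d : ℝ≥0) : ℝ≥0∞) * ν B := fun t ht => by
      have := map_withDensity_hausdorffMeasure_le_mul hd hT hTT hTS hg hg0 hgT hdist ht B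
      rwa [Measure.smul_apply, ← ENNReal.coe_rpow_of_nonneg _ hd] at this
    have hlim : Filter.Tendsto (fun t : ℝ≥0 => ((t ^ d : ℝ≥0) : ℝ≥0∞) * ν B)
        (nhdsWithin 1 (Set.Ioi 1)) (nhds (((1 ^ d : ℝ≥0) : ℝ≥0∞) * ν B)) := by
      refine Filter.Tendsto.mono_left ?_ nhdsWithin_le_nhds
      refine ENNReal.Tendsto.mul_const ?_ (Or.inl (by simp))
      exact ENNReal.tendsto_coe.2 (NNReal.continuousAt_rpow_const (Or.inl one_ne_zero))
    have := ge_of_tendsto hlim (eventually_nhdsWithin_of_forall h1)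
    simpa using this
  refine le_antisymm hle ?_
  calc ν = (ν.map T).map T := by
        rw [Measure.map_map hT hT, hTT.comp_self, Measure.map_id]
    _ ≤ ν.map T := Measure.map_mono hle hT

/-- The `k`-dimensional Hausdorff measure of a sphere in a `k + 1`-dimensional Euclidean space is
finite. -/
theorem hausdorffMeasure_sphere_lt_top {E : Type*} [NormedAddCommGroup E] [InnerProductSpace ℝ E]
    [FiniteDimensional ℝ E] [MeasurableSpace E] [BorelSpace E] {k : ℕ}
    (hk : Module.finrank ℝ E = k + 1) {R : ℝ} (hR : 0 < R) :
    μH[(k : ℝ)] (Metric.sphere (0 : E) R) < ∞ := by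
  refine (isCompact_sphere _ _).measure_lt_top_of_nhdsWithin fun p hp => ?_
  have hpn : ‖p‖ = R := by simpa using hp
  have hp0 : p ≠ 0 := by
    rintro rfl
    simp at hpn
    exact hR.ne hpn
  have : Fact (Module.finrank ℝ E = k + 1) := ⟨hk⟩
  set W := (Submodule.span ℝ {p})ᗮ with hW
  have hWk : Module.finrank ℝ W = k := Submodule.finrank_orthogonal_span_singleton hp0
  have horth : ∀ u : W, inner ℝ p (u : E) = 0 := fun u =>
    Submodule.mem_orthogonal_singleton_iff_inner_right.1 u.2
  have hne : ∀ u : W, p + (u : E) ≠ 0 := by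
    intro u h
    have h1 : inner ℝ p (p + (u : E)) = 0 := by rw [h, inner_zero_right]
    rw [inner_add_right, horth, real_inner_self_eq_norm_sq, hpn] at h1
    nlinarith
  let f : W → E := fun u => (R / ‖p + (u : E)‖) • (p + (u : E))
  have hf : ContDiff ℝ 1 f := by
    have h1 : ContDiff ℝ 1 fun u : W => p + (u : E) :=
      contDiff_const.add W.subtypeL.contDiff
    exact (contDiff_const.div (h1.norm ℝ hne) fun u => norm_ne_zero_iff.2 (hne u)).smul h1
  obtain ⟨K, hK⟩ := hf.contDiffOn.exists_lipschitzOnWith one_ne_zero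
    (convex_closedBall (0 : W) (3 * R)) (isCompact_closedBall _ _)
  have hfin : μH[(k : ℝ)] (f '' Metric.closedBall (0 : W) (3 * R)) < ∞ := by
    refine (hK.hausdorffMeasure_image_le k.cast_nonneg).trans_lt (ENNReal.mul_lt_top ?_ ?_)
    · exact ENNReal.rpow_lt_top_of_nonneg k.cast_nonneg ENNReal.coe_ne_top
    · have := isAddHaarMeasure_hausdorffMeasure (E := W)
      rw [hWk] at this
      exact (isCompact_closedBall _ _).measure_lt_top
  refine ⟨_, ?_, hfin⟩
  have hopen : {y : E | R ^ 2 / 2 < inner ℝ p y} ∈ nhds p := by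
    refine (isOpen_lt continuous_const (by fun_prop)).mem_nhds ?_
    change R ^ 2 / 2 < inner ℝ p p
    rw [real_inner_self_eq_norm_sq, hpn]
    nlinarith
  filter_upwards [self_mem_nhdsWithin, mem_nhdsWithin_of_mem_nhds hopen] with y hy hy2
  have hyn : ‖y‖ = R := by simpa using hy
  change R ^ 2 / 2 < inner ℝ p y at hy2
  have hi : 0 < inner ℝ p y := lt_trans (by positivity) hy2
  set c := R ^ 2 / inner ℝ p y with hc
  have hc0 : 0 < c := by positivity
  have hc2 : c ≤ 2 := by
    rw [hc, div_le_iff₀ hi]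
    linarith
  have hmem : c • y - p ∈ W := by
    rw [hW, Submodule.mem_orthogonal_singleton_iff_inner_right, inner_sub_right, inner_smul_right,
      real_inner_self_eq_norm_sq, hpn, hc]
    field_simp
    ring
  refine ⟨⟨c • y - p, hmem⟩, ?_, ?_⟩
  · rw [mem_closedBall_zero_iff, Submodule.coe_norm]
    calc ‖c • y - p‖ ≤ ‖c • y‖ + ‖p‖ := norm_sub_le _ _
      _ = c * R + R := by rw [norm_smul, hyn, hpn, Real.norm_of_nonneg hc0.le]
      _ ≤ 3 * R := by nlinarith
  · simp only [f, add_sub_cancel, norm_smul, hyn, Real.norm_of_nonneg hc0.le, smul_smul]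
    rw [show R / (c * R) * c = 1 by field_simp, one_smul]

/-- The inversion of signed power `c` centered at `x`. -/
noncomputable def signedInversion {E : Type*} [NormedAddCommGroup E] [InnerProductSpace ℝ E]
    (c : ℝ) (x y : E) : E :=
  x + (c / ‖y - x‖ ^ 2) • (y - x)

section signedInversion

variable {E : Type*} [NormedAddCommGroup E] [InnerProductSpace ℝ E] {c : ℝ} {x y z : E}

theorem signedInversion_involutive (hc : c ≠ 0) :
    Function.Involutive (signedInversion c x) := by
  intro y
  by_cases h : y - x = 0
  · simp [signedInversion, sub_eq_zero.1 h]
  · have h' : ‖y - x‖ ≠ 0 := norm_ne_zero_iff.2 h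
    simp only [signedInversion, add_sub_cancel_left, norm_smul, Real.norm_eq_abs, smul_smul,
      mul_pow, sq_abs]
    rw [show c / ((c / ‖y - x‖ ^ 2) ^ 2 * ‖y - x‖ ^ 2) * (c / ‖y - x‖ ^ 2) = 1 by field_simp,
      one_smul, add_sub_cancel]

theorem norm_sub_signedInversion_sq (hy : y ≠ x) :
    ‖x - signedInversion c x y‖ ^ 2 = c ^ 2 / ‖x - y‖ ^ 2 := by
  have h' : ‖y - x‖ ≠ 0 := norm_ne_zero_iff.2 (sub_ne_zero.2 hy)
  rw [norm_sub_rev x, norm_sub_rev x]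
  simp only [signedInversion, add_sub_cancel_left, norm_smul, Real.norm_eq_abs, mul_pow, sq_abs]
  field_simp

theorem dist_signedInversion_sq (hy : y ≠ x) (hz : z ≠ x) :
    dist (signedInversion c x y) (signedInversion c x z) ^ 2 =
      c ^ 2 / (‖x - y‖ ^ 2 * ‖x - z‖ ^ 2) * dist y z ^ 2 := by
  have h1 : ‖y - x‖ ≠ 0 := norm_ne_zero_iff.2 (sub_ne_zero.2 hy)
  have h2 : ‖z - x‖ ≠ 0 := norm_ne_zero_iff.2 (sub_ne_zero.2 hz)
  rw [norm_sub_rev x, norm_sub_rev x, dist_eq_norm, dist_eq_norm,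
    show y - z = (y - x) - (z - x) by abel]
  simp only [signedInversion, add_sub_add_left_eq_sub]
  generalize y - x = a at *
  generalize z - x = b at *
  rw [norm_sub_sq_real, norm_sub_sq_real, norm_smul, norm_smul, inner_smul_left, inner_smul_right,
    mul_pow, mul_pow, Real.norm_eq_abs, Real.norm_eq_abs, sq_abs, sq_abs]
  simp only [conj_trivial]
  field_simp
  ring

theorem norm_signedInversion {R : ℝ} (hR : 0 ≤ R) (hx : ‖x‖ ≠ R) (hy : ‖y‖ = R) :
    ‖signedInversion (‖x‖ ^ 2 - R ^ 2) x y‖ = R := by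
  have hne : y ≠ x := by
    rintro rfl
    exact hx hy
  have h1 : ‖y - x‖ ≠ 0 := norm_ne_zero_iff.2 (sub_ne_zero.2 hne)
  have h2 : R ^ 2 = ‖x‖ ^ 2 + 2 * inner ℝ x (y - x) + ‖y - x‖ ^ 2 := by
    rw [← norm_add_sq_real, add_sub_cancel, hy]
  rw [← sq_eq_sq₀ (norm_nonneg _) hR]
  simp only [signedInversion]
  rw [norm_add_sq_real, norm_smul, inner_smul_right, mul_pow, Real.norm_eq_abs, sq_abs]
  have h3 : inner ℝ x (y - x) = (R ^ 2 - ‖x‖ ^ 2 - ‖y - x‖ ^ 2) / 2 := by linarith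
  rw [h3]
  field_simp
  ring

theorem measurable_signedInversion [MeasurableSpace E] [BorelSpace E]
    [SecondCountableTopology E] : Measurable (signedInversion c x) := by
  unfold signedInversion
  fun_prop

end signedInversion

section sRatio

variable {n : ℕ} {R : ℝ} {x y : EuclideanSpace ℝ (Fin n)}

theorem sRatio_nonneg : 0 ≤ sRatio R x y := by
  unfold sRatio
  positivity

theorem sq_sub_sq_ne_zero (hR : 0 < R) (hx : ‖x‖ ≠ R) : ‖x‖ ^ 2 - R ^ 2 ≠ 0 := by
  rw [sub_ne_zero, Ne, sq_eq_sq₀ (norm_nonneg _) hR.le]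
  exact hx

theorem ne_of_mem_sphere_of_norm_ne (hx : ‖x‖ ≠ R) (hy : y ∈ Metric.sphere 0 R) : y ≠ x := by
  rintro rfl
  exact hx (by simpa using hy)

theorem sRatio_pos (hR : 0 < R) (hx : ‖x‖ ≠ R) (hy : y ∈ Metric.sphere 0 R) :
    0 < sRatio R x y := by
  have h1 := abs_pos.2 (sq_sub_sq_ne_zero hR hx)
  have h2 : 0 < ‖x - y‖ :=
    norm_pos_iff.2 (sub_ne_zero.2 (ne_of_mem_sphere_of_norm_ne hx hy).symm)
  unfold sRatio
  positivity

theorem measurable_sRatio : Measurable (sRatio R x) := by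
  unfold sRatio
  fun_prop

theorem continuousOn_sRatio (hx : ‖x‖ ≠ R) : ContinuousOn (sRatio R x) (Metric.sphere 0 R) := by
  unfold sRatio
  refine continuousOn_const.div (by fun_prop) fun y hy => ?_
  exact pow_ne_zero _ (norm_ne_zero_iff.2 (sub_ne_zero.2 (ne_of_mem_sphere_of_norm_ne hx hy).symm))

theorem sRatio_signedInversion (hR : 0 < R) (hx : ‖x‖ ≠ R) (hy : y ∈ Metric.sphere 0 R) :
    sRatio R x (signedInversion (‖x‖ ^ 2 - R ^ 2) x y) = (sRatio R x y)⁻¹ := by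
  have hne := ne_of_mem_sphere_of_norm_ne hx hy
  have h1 := abs_pos.2 (sq_sub_sq_ne_zero hR hx)
  have h2 : ‖x - y‖ ≠ 0 := norm_ne_zero_iff.2 (sub_ne_zero.2 hne.symm)
  rw [sRatio, sRatio, norm_sub_signedInversion_sq hne, ← sq_abs (‖x‖ ^ 2 - R ^ 2)]
  field_simp

/-- The odd logarithmic moments of the spherical ratio with weight `ω ^ (k / 2)` vanish. -/
theorem integral_sRatio_rpow_mul_log_pow_of_odd {k : ℕ} (hR : 0 < R) (hx : ‖x‖ ≠ R) {m : ℕ}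
    (hm : Odd m) :
    ∫ y in Metric.sphere (0 : EuclideanSpace ℝ (Fin n)) R,
      sRatio R x y ^ ((k : ℝ) / 2) * Real.log (sRatio R x y) ^ m ∂μH[(k : ℝ)] = 0 := by
  set T := signedInversion (‖x‖ ^ 2 - R ^ 2) x with hTdef
  have hc := sq_sub_sq_ne_zero hR hx
  set S := Metric.sphere (0 : EuclideanSpace ℝ (Fin n)) R
  have hS : MeasurableSet S := Metric.isClosed_sphere.measurableSet
  set g : EuclideanSpace ℝ (Fin n) → ℝ≥0 := fun y => (sRatio R x y).toNNReal with hgdef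
  have hg : Measurable g := measurable_sRatio.real_toNNReal
  have hT : Measurable T := measurable_signedInversion
  have hTT : Function.Involutive T := signedInversion_involutive hc
  have hgc : ∀ y, (g y : ℝ) = sRatio R x y := fun y => Real.coe_toNNReal _ sRatio_nonneg
  have hmp := measurePreserving_withDensity_hausdorffMeasure (d := k) k.cast_nonneg hT hTT
    (fun y hy => by
      rw [mem_sphere_zero_iff_norm] at hy ⊢
      exact norm_signedInversion hR.le hx hy) hg
    (fun y hy => (Real.toNNReal_pos.2 (sRatio_pos hR hx hy)).ne')
    (fun y hy => by
      simp only [hgdef, hTdef]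
      rw [sRatio_signedInversion hR hx hy, Real.toNNReal_inv])
    (fun y hy z hz => by
      rw [hgc, hgc, hTdef, dist_signedInversion_sq (ne_of_mem_sphere_of_norm_ne hx hy)
        (ne_of_mem_sphere_of_norm_ne hx hz), sRatio, sRatio, div_mul_div_comm, abs_mul_abs_self,
        sq (‖x‖ ^ 2 - R ^ 2)])
  set ν := (μH[(k : ℝ)].restrict S).withDensity
    fun y => ((g y ^ ((k : ℝ) / 2) : ℝ≥0) : ℝ≥0∞) with hν
  have hint : ∫ y in S, sRatio R x y ^ ((k : ℝ) / 2) * Real.log (sRatio R x y) ^ m ∂μH[(k : ℝ)]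
      = ∫ y, Real.log (sRatio R x y) ^ m ∂ν := by
    rw [hν, integral_withDensity_eq_integral_smul (by fun_prop)]
    refine integral_congr_ae (Filter.Eventually.of_forall fun y => ?_)
    simp only [NNReal.smul_def, NNReal.coe_rpow, hgc, smul_eq_mul]
  have hSν : ∀ᵐ y ∂ν, y ∈ S :=
    (withDensity_absolutelyContinuous _ _).ae_le (ae_restrict_mem hS)
  have hcomp := hmp.integral_comp (MeasurableEquiv.ofInvolutive T hTT hT).measurableEmbedding
    fun y => Real.log (sRatio R x y) ^ m
  have hneg : ∫ y, Real.log (sRatio R x (T y)) ^ m ∂ν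
      = - ∫ y, Real.log (sRatio R x y) ^ m ∂ν := by
    rw [← integral_neg]
    refine integral_congr_ae ?_
    filter_upwards [hSν] with y hy
    rw [hTdef, sRatio_signedInversion hR hx hy, Real.log_inv, hm.neg_pow]
  rw [hint]
  linarith

end sRatio

/-- If `L` is a bounded function and `w` is integrable, `∫ w exp (s L)` is an entire function of
`s`, given by its Taylor series at `0`. -/
theorem hasSum_integral_mul_exp {X : Type*} [MeasurableSpace X] {μ : Measure X} {w L : X → ℝ}
    (hw : Integrable w μ) (hL : Measurable L) {M : ℝ}
    (hM : ∀ᵐ y ∂μ, |L y| ≤ M) (s : ℂ) :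
    HasSum (fun n : ℕ => s ^ n / (n.factorial : ℂ) * ((∫ y, w y * L y ^ n ∂μ : ℝ) : ℂ))
      (∫ y, (w y : ℂ) * Complex.exp (s * L y) ∂μ) := by
  have hint : ∀ n : ℕ, Integrable (fun y => w y * L y ^ n) μ := by
    intro n
    refine hw.mul_bdd (c := M ^ n) (hL.pow_const n).aestronglyMeasurable ?_
    filter_upwards [hM] with y hy
    rw [norm_pow, Real.norm_eq_abs]
    gcongr
  have hsum := hasSum_integral_of_summable_integral_norm (μ := μ)
    (F := fun (n : ℕ) y => s ^ n / (n.factorial : ℂ) * ((w y * L y ^ n : ℝ) : ℂ))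
    (fun n => (hint n).ofReal.const_mul _) ?_
  · simp only [integral_const_mul, integral_complex_ofReal] at hsum
    have hexp : ∫ y, (w y : ℂ) * Complex.exp (s * L y) ∂μ
        = ∫ y, ∑' n : ℕ, s ^ n / (n.factorial : ℂ) * ((w y * L y ^ n : ℝ) : ℂ) ∂μ := by
      refine integral_congr_ae (Filter.Eventually.of_forall fun y => ?_)
      have h1 := NormedSpace.expSeries_div_hasSum_exp (s * (L y : ℂ))
      rw [← Complex.exp_eq_exp_ℂ] at h1
      have h2 := h1.mul_left (w y : ℂ)
      refine h2.tsum_eq.symm.trans (tsum_congr fun n => ?_)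
      push_cast
      ring
    rw [hexp]
    exact hsum
  · refine Summable.of_nonneg_of_le (fun n => integral_nonneg fun y => norm_nonneg _)
      (fun n => ?_) ((Real.summable_pow_div_factorial (‖s‖ * M)).mul_right (∫ y, ‖w y‖ ∂μ))
    rw [← integral_const_mul]
    refine integral_mono_ae ((hint n).ofReal.const_mul _).norm (hw.norm.const_mul _) ?_
    filter_upwards [hM] with y hy
    have h1 : |L y| ^ n ≤ M ^ n := by gcongr
    simp only [norm_mul, norm_div, norm_pow, Complex.norm_real, Real.norm_eq_abs,
      Complex.norm_natCast, mul_pow]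
    rw [show ‖s‖ ^ n * M ^ n / (n.factorial : ℝ) * |w y|
      = ‖s‖ ^ n / (n.factorial : ℝ) * (|w y| * M ^ n) by ring]
    gcongr

/-- The Taylor expansion of `F(α) = ∫_{S^k(R)} ω^α dS_y` at `α = k/2` contains only even
powers and converges to `F(α)` for every `α ∈ ℂ`. -/
theorem stmt_6 (k : ℕ) (hk : 1 ≤ k) (R : ℝ) (hR : 0 < R)
    (x : EuclideanSpace ℝ (Fin (k + 1))) (hx : ‖x‖ ≠ R) (α : ℂ) :
    HasSum
      (fun m : ℕ =>
        (α - (k : ℂ) / 2) ^ (2 * m) / ((2 * m).factorial : ℂ) *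
          ((∫ y in Metric.sphere (0 : EuclideanSpace ℝ (Fin (k + 1))) R,
              (sRatio R x y) ^ ((k : ℝ) / 2) *
                (Real.log (sRatio R x y)) ^ (2 * m) ∂(μH[(k : ℝ)]) : ℝ) : ℂ))
      (∫ y in Metric.sphere (0 : EuclideanSpace ℝ (Fin (k + 1))) R,
        Complex.exp (α * (Real.log (sRatio R x y) : ℂ)) ∂(μH[(k : ℝ)])) := by
  set S := Metric.sphere (0 : EuclideanSpace ℝ (Fin (k + 1))) R
  have hS : MeasurableSet S := Metric.isClosed_sphere.measurableSet
  have hfin : μH[(k : ℝ)] S < ⊤ := hausdorffMeasure_sphere_lt_top (by simp) hR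
  have hfm : IsFiniteMeasure (μH[(k : ℝ)].restrict S) := isFiniteMeasure_restrict.2 hfin.ne
  have hpos : ∀ y ∈ S, 0 < sRatio R x y := fun y hy => sRatio_pos hR hx hy
  have hcont := continuousOn_sRatio hx
  have hcompact : IsCompact S := isCompact_sphere _ _
  obtain ⟨M, hM⟩ := hcompact.exists_bound_of_continuousOn
    (hcont.log fun y hy => (hpos y hy).ne')
  have hw : Integrable (fun y => sRatio R x y ^ ((k : ℝ) / 2)) (μH[(k : ℝ)].restrict S) := by
    obtain ⟨C, hC⟩ := hcompact.exists_bound_of_continuousOn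
      (hcont.rpow_const (p := (k : ℝ) / 2) fun y hy => Or.inl (hpos y hy).ne')
    exact Integrable.of_bound (measurable_sRatio.pow_const _).aestronglyMeasurable C
      ((ae_restrict_mem hS).mono hC)
  have key := hasSum_integral_mul_exp hw measurable_sRatio.log
    ((ae_restrict_mem hS).mono hM) (α - (k : ℂ) / 2)
  have hexp : ∫ y in S, Complex.exp (α * (Real.log (sRatio R x y) : ℂ)) ∂(μH[(k : ℝ)])
      = ∫ y in S, ((sRatio R x y ^ ((k : ℝ) / 2) : ℝ) : ℂ) *
        Complex.exp ((α - (k : ℂ) / 2) * (Real.log (sRatio R x y) : ℂ)) ∂(μH[(k : ℝ)]) := by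
    refine setIntegral_congr_fun hS fun y hy => ?_
    rw [Real.rpow_def_of_pos (hpos y hy), Complex.ofReal_exp, ← Complex.exp_add]
    congr 1
    push_cast
    ring
  rw [hexp]
  refine (Function.Injective.hasSum_iff (g := fun m : ℕ => 2 * m)
    (mul_right_injective₀ two_ne_zero) fun n hn => ?_).2 key
  have hodd : Odd n := by
    rw [← Nat.not_even_iff_odd]
    rintro ⟨m, rfl⟩
    exact hn ⟨m, two_mul m⟩
  rw [integral_sRatio_rpow_mul_log_pow_of_odd hR hx hodd]
  simp
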